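/- arXiv:2303.08629 — 5 statements merged into one kernel-verified Lean document; each statement's English description precedes it below -/
import Mathlib

section
/- Let T > 1, let w₀ > 0 and r > 0, and let φ : [0, ∞) → ℝ be a non-increasing and nonnegative function such that φ(t)^{1+r} ≤ w₀ (φ(t) − φ(t+1)) for all t ∈ [0, T]. Then φ(t) ≤ ( φ(0)^{−r} + w₀^{−1} r · max(t − 1, 0) )^{−1/r} for all t ∈ [0, T]. -/
/-- The tangent line inequality for `x ↦ x ^ (-r)`, in scaled form. -/
lemma rpow_neg_add_le_rpow_neg {a b w r : ℝ} (ha : 0 < a) (hb : 0 < b) (hw : 0 < w)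
    (hr : 0 ≤ r) (h : a ^ (1 + r) ≤ w * (a - b)) :
    a ^ (-r) + w⁻¹ * r ≤ b ^ (-r) := by
  have hlog : Real.log (b / a) ≤ b / a - 1 := Real.log_le_sub_one_of_pos (by positivity)
  have hexp : 1 + r * (1 - b / a) ≤ (b / a) ^ (-r) := by
    rw [Real.rpow_def_of_pos (by positivity)]
    nlinarith [Real.add_one_le_exp (Real.log (b / a) * -r)]
  have hpos : 0 < a ^ (-r) := Real.rpow_pos_of_pos ha _
  rw [Real.div_rpow hb.le ha.le, le_div_iff₀ hpos] at hexp
  have hone : a ^ (1 + r) * a ^ (-r) = a := by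
    rw [← Real.rpow_add ha]; simp
  have hdiff : w⁻¹ ≤ (1 - b / a) * a ^ (-r) := by
    have h' : a ≤ w * (a - b) * a ^ (-r) :=
      hone.symm.le.trans (mul_le_mul_of_nonneg_right h hpos.le)
    have heq : (1 - b / a) * a ^ (-r) = w⁻¹ * (w * (a - b) * a ^ (-r) / a) := by
      field_simp
    rw [heq]
    exact le_mul_of_one_le_right (by positivity) ((one_le_div ha).2 h')
  nlinarith [mul_le_mul_of_nonneg_left hdiff hr]

/-- Iterating the difference inequality along `s, s + 1, s + 2, …`. -/
lemma rpow_neg_add_nat_mul_le {T w r : ℝ} (hw : 0 < w) (hr : 0 ≤ r) {φ : ℝ → ℝ}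
    (hanti : ∀ s t, 0 ≤ s → s ≤ t → φ t ≤ φ s)
    (hineq : ∀ t, 0 ≤ t → t ≤ T → φ t ^ (1 + r) ≤ w * (φ t - φ (t + 1)))
    {s : ℝ} (hs : 0 ≤ s) (n : ℕ) (hT : s + n ≤ T) (hpos : 0 < φ (s + n)) :
    φ s ^ (-r) + n * (w⁻¹ * r) ≤ φ (s + n) ^ (-r) := by
  induction n with
  | zero => simp
  | succ n ih =>
    push_cast [← add_assoc] at hT hpos ⊢
    have hn : 0 ≤ s + n := by positivity
    have hpos' : 0 < φ (s + n) := hpos.trans_le (hanti _ _ hn (by linarith))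
    have hstep := rpow_neg_add_le_rpow_neg hpos' hpos hw hr (hineq _ hn (by linarith))
    linarith [ih (by linarith) hpos']


/-- Nakao's decay lemma, case `r > 0` (Lemma 4.1 of the paper): if `φ` is
non-increasing and nonnegative on `[0, ∞)` and satisfies
`φ(t)^(1+r) ≤ w₀ (φ(t) − φ(t+1))` on `[0, T]` with `T > 1`, then
`φ(t) ≤ (φ(0)^(−r) + w₀⁻¹ r [t−1]⁺)^(−1/r)` on `[0, T]`. -/
theorem nakao_decay_polynomial (T w₀ r : ℝ) (hT : 1 < T) (hw₀ : 0 < w₀) (hr : 0 < r)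
    (φ : ℝ → ℝ)
    (hφ_nonneg : ∀ t, 0 ≤ t → 0 ≤ φ t)
    (hφ_anti : ∀ s t, 0 ≤ s → s ≤ t → φ t ≤ φ s)
    (hineq : ∀ t, 0 ≤ t → t ≤ T → φ t ^ (1 + r) ≤ w₀ * (φ t - φ (t + 1))) :
    ∀ t, 0 ≤ t → t ≤ T →
      φ t ≤ (φ 0 ^ (-r) + w₀⁻¹ * r * max (t - 1) 0) ^ (-(1 / r)) := by
  intro t ht htT
  have hc : 0 < w₀⁻¹ * r := by positivity
  have hφ0 := hφ_nonneg 0 le_rfl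
  rcases (hφ_nonneg t ht).eq_or_lt with h0 | hpos
  · rw [← h0]
    positivity
  have hs : 0 ≤ t - ⌊t⌋₊ := sub_nonneg.2 (Nat.floor_le ht)
  have hs1 : t - ⌊t⌋₊ ≤ t := sub_le_self _ (Nat.cast_nonneg _)
  have hφs : 0 < φ (t - ⌊t⌋₊) := hpos.trans_le (hφ_anti _ _ hs hs1)
  have hφs0 : φ (t - ⌊t⌋₊) ≤ φ 0 := hφ_anti _ _ le_rfl hs
  have hiter := rpow_neg_add_nat_mul_le hw₀ hr.le hφ_anti hineq hs ⌊t⌋₊ (by simpa using htT)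
    (by simpa using hpos)
  rw [sub_add_cancel] at hiter
  have hanti0 : φ 0 ^ (-r) ≤ φ (t - ⌊t⌋₊) ^ (-r) :=
    Real.rpow_le_rpow_of_nonpos hφs hφs0 (by linarith)
  have hfloor : max (t - 1) 0 ≤ ⌊t⌋₊ :=
    max_le (by linarith [Nat.lt_floor_add_one t]) (Nat.cast_nonneg _)
  have hle : φ 0 ^ (-r) + w₀⁻¹ * r * max (t - 1) 0 ≤ φ t ^ (-r) := by
    linarith [mul_le_mul_of_nonneg_left hfloor hc.le]
  have hbase : 0 < φ 0 ^ (-r) + w₀⁻¹ * r * max (t - 1) 0 :=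
    add_pos_of_pos_of_nonneg (Real.rpow_pos_of_pos (hφs.trans_le hφs0) _) (by positivity)
  calc φ t = (φ t ^ (-r)) ^ (-(1 / r)) := by
        rw [← Real.rpow_mul hpos.le, neg_mul_neg, mul_one_div_cancel hr.ne', Real.rpow_one]
    _ ≤ _ := Real.rpow_le_rpow_of_nonpos hbase hle (by simp [hr.le])
end

section
/- Let T > 1, let w₀ > 1, and let φ : [0, ∞) → ℝ be a non-increasing and nonnegative function such that φ(t) ≤ w₀ (φ(t) − φ(t+1)) for all t ∈ [0, T]. Then φ(t) ≤ φ(0) · exp(−w₁ · max(t − 1, 0)) for all t ∈ [0, T], where w₁ = log( w₀ / (w₀ − 1) ). -/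
/-- A function contracting by a factor `exp (-c)` over unit steps in `[0, T]` decays
geometrically along the natural numbers up to `T`. -/
theorem le_mul_exp_of_unit_step {φ : ℝ → ℝ} {c T : ℝ}
    (hstep : ∀ t, 0 ≤ t → t ≤ T → φ (t + 1) ≤ φ t * Real.exp (-c)) (n : ℕ) (hn : n ≤ T) :
    φ n ≤ φ 0 * Real.exp (-c * n) := by
  induction n with
  | zero => simp
  | succ k ih =>
    push_cast at hn ⊢
    have hk : (k : ℝ) ≤ T := by linarith
    calc φ (k + 1) ≤ φ k * Real.exp (-c) := hstep k k.cast_nonneg hk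
      _ ≤ φ 0 * Real.exp (-c * k) * Real.exp (-c) := by gcongr; exact ih hk
      _ = φ 0 * Real.exp (-c * (k + 1)) := by
        rw [mul_assoc, ← Real.exp_add]
        ring_nf

/-- Nakao's decay lemma, case `r = 0` (Lemma 4.1 of the paper): if `φ` is
non-increasing and nonnegative on `[0, ∞)` and satisfies
`φ(t) ≤ w₀ (φ(t) − φ(t+1))` on `[0, T]` with `T > 1` and `w₀ > 1`, then
`φ(t) ≤ φ(0) exp(−w₁ [t−1]⁺)` on `[0, T]`, where `w₁ = log (w₀ / (w₀ − 1))`. -/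
theorem nakao_decay_exponential (T w₀ : ℝ) (hT : 1 < T) (hw₀ : 1 < w₀)
    (φ : ℝ → ℝ)
    (hφ_nonneg : ∀ t, 0 ≤ t → 0 ≤ φ t)
    (hφ_anti : ∀ s t, 0 ≤ s → s ≤ t → φ t ≤ φ s)
    (hineq : ∀ t, 0 ≤ t → t ≤ T → φ t ≤ w₀ * (φ t - φ (t + 1))) :
    ∀ t, 0 ≤ t → t ≤ T →
      φ t ≤ φ 0 * Real.exp (-(Real.log (w₀ / (w₀ - 1))) * max (t - 1) 0) := by
  intro t ht htT
  have hpos : 0 < w₀ - 1 := by linarith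
  have hw₀_pos : 0 < w₀ := by linarith
  set c := Real.log (w₀ / (w₀ - 1)) with hc
  have hc_nonneg : 0 ≤ c := Real.log_nonneg (by rw [le_div_iff₀ hpos]; linarith)
  have hexp : Real.exp (-c) = (w₀ - 1) / w₀ := by
    rw [Real.exp_neg, hc, Real.exp_log (by positivity), inv_div]
  have hstep : ∀ s, 0 ≤ s → s ≤ T → φ (s + 1) ≤ φ s * Real.exp (-c) := by
    intro s hs hsT
    rw [hexp, ← mul_div_assoc, le_div_iff₀ hw₀_pos]
    linarith [hineq s hs hsT]
  have hfloor : (⌊t⌋₊ : ℝ) ≤ t := Nat.floor_le ht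
  have hmax : max (t - 1) 0 ≤ (⌊t⌋₊ : ℝ) :=
    max_le (by linarith [Nat.lt_floor_add_one t]) (Nat.cast_nonneg _)
  calc φ t ≤ φ ⌊t⌋₊ := hφ_anti _ _ (Nat.cast_nonneg _) hfloor
    _ ≤ φ 0 * Real.exp (-c * ⌊t⌋₊) := le_mul_exp_of_unit_step hstep _ (hfloor.trans htT)
    _ ≤ φ 0 * Real.exp (-c * max (t - 1) 0) := by
      refine mul_le_mul_of_nonneg_left (Real.exp_le_exp.mpr ?_) (hφ_nonneg 0 le_rfl)
      exact mul_le_mul_of_nonpos_left hmax (by linarith)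
end

section
/- Let q > 2, A > 0, C > 0 and B ∈ ℝ. Define j : (0, ∞) → ℝ by j(λ) = (A/2)λ² − (λ^q/q)(B + C·log λ) + (C/q²)λ^q. Then: (i) j(λ) → 0 as λ → 0⁺ and j(λ) → −∞ as λ → +∞; (ii) there exists a unique λ* > 0 such that the function λ·j′(λ) = Aλ² − λ^q (B + C·log λ) is strictly positive for 0 < λ < λ*, equals 0 at λ = λ*, and is strictly negative for λ > λ*. -/
open Filter Set

theorem sq_eq_rpow_mul_rpow_two_sub (q : ℝ) {l : ℝ} (hl : 0 < l) :
    l ^ 2 = l ^ q * l ^ (2 - q) := by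
  rw [← Real.rpow_add hl, add_sub_cancel, Real.rpow_two]

theorem tendsto_fibering_nhdsGT_zero (A B C : ℝ) {q : ℝ} (hq : 0 < q) :
    Tendsto (fun l : ℝ => A / 2 * l ^ 2 - l ^ q / q * (B + C * Real.log l) + C / q ^ 2 * l ^ q)
      (nhdsWithin 0 (Ioi 0)) (nhds 0) := by
  have h_sq : Tendsto (fun l : ℝ => l ^ 2) (nhdsWithin 0 (Ioi 0)) (nhds 0) :=
    tendsto_nhdsWithin_of_tendsto_nhds (by simpa using (continuous_pow 2).tendsto (0 : ℝ))
  have h_rpow : Tendsto (fun l : ℝ => l ^ q) (nhdsWithin 0 (Ioi 0)) (nhds 0) := by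
    have h := (Real.continuousAt_rpow_const 0 q (Or.inr hq.le)).tendsto
    rw [Real.zero_rpow hq.ne'] at h
    exact tendsto_nhdsWithin_of_tendsto_nhds h
  have h_log := tendsto_log_mul_rpow_nhdsGT_zero hq
  have h := (((h_sq.const_mul (A / 2)).sub (h_rpow.const_mul (B / q))).sub
    (h_log.const_mul (C / q))).add (h_rpow.const_mul (C / q ^ 2))
  simp only [mul_zero, sub_zero, add_zero] at h
  refine h.congr fun l => ?_
  ring

theorem tendsto_rpow_two_sub_sub_log_atTop (a b : ℝ) {c q : ℝ} (hq : 2 < q) (hc : 0 < c) :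
    Tendsto (fun l : ℝ => a * l ^ (2 - q) - (b + c * Real.log l)) atTop atBot := by
  have h_rpow : Tendsto (fun l : ℝ => l ^ (2 - q)) atTop (nhds 0) := by
    simpa using tendsto_rpow_neg_atTop (sub_pos.2 hq)
  have h_log : Tendsto (fun l : ℝ => b + c * Real.log l) atTop atTop :=
    tendsto_atTop_add_const_left _ _ (Real.tendsto_log_atTop.const_mul_atTop hc)
  simpa only [sub_eq_add_neg, Function.comp_def] using
    (h_rpow.const_mul a).add_atBot (tendsto_neg_atTop_atBot.comp h_log)

theorem tendsto_fibering_atTop (A B : ℝ) {C q : ℝ} (hq : 2 < q) (hC : 0 < C) :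
    Tendsto (fun l : ℝ => A / 2 * l ^ 2 - l ^ q / q * (B + C * Real.log l) + C / q ^ 2 * l ^ q)
      atTop atBot := by
  have hq0 : 0 < q := by linarith
  have h := (tendsto_rpow_atTop hq0).atTop_mul_atBot₀
    (tendsto_rpow_two_sub_sub_log_atTop (A / 2) (B / q - C / q ^ 2) hq (div_pos hC hq0))
  refine h.congr' ?_
  filter_upwards [eventually_gt_atTop 0] with l hl
  rw [sq_eq_rpow_mul_rpow_two_sub q hl]
  ring

theorem strictAntiOn_rpow_two_sub_sub_log {A C q : ℝ} (B : ℝ) (hq : 2 < q) (hA : 0 < A)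
    (hC : 0 < C) :
    StrictAntiOn (fun l : ℝ => A * l ^ (2 - q) - (B + C * Real.log l)) (Ioi 0) := by
  intro x hx y _ hxy
  have h_rpow := mul_lt_mul_of_pos_left
    (Real.rpow_lt_rpow_of_neg hx hxy (by linarith : 2 - q < 0)) hA
  have h_log := mul_lt_mul_of_pos_left (Real.log_lt_log hx hxy) hC
  dsimp only
  linarith

theorem exists_pos_rpow_two_sub_sub_log_eq_zero {A C q : ℝ} (B : ℝ) (hq : 2 < q) (hA : 0 < A)
    (hC : 0 < C) :
    ∃ l : ℝ, 0 < l ∧ A * l ^ (2 - q) - (B + C * Real.log l) = 0 := by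
  obtain ⟨b, hb, hb0⟩ := (((tendsto_rpow_two_sub_sub_log_atTop A B hq hC).eventually_lt_atBot
    0).and (eventually_gt_atTop 0)).exists
  have ha0 : 0 < Real.exp (-B / C) := Real.exp_pos _
  have ha : 0 < A * Real.exp (-B / C) ^ (2 - q) - (B + C * Real.log (Real.exp (-B / C))) := by
    rw [Real.log_exp, mul_div_cancel₀ _ hC.ne', add_neg_cancel, sub_zero]
    positivity
  have h_cont : ContinuousOn (fun l : ℝ => A * l ^ (2 - q) - (B + C * Real.log l)) (Ioi 0) := by
    intro l hl
    have hl0 : l ≠ 0 := ne_of_gt hl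
    exact (((Real.continuousAt_rpow_const l (2 - q) (Or.inl hl0)).const_mul A).sub
      (((Real.continuousAt_log hl0).const_mul C).const_add B)).continuousWithinAt
  obtain ⟨l, hl, h_zero⟩ := isPreconnected_Ioi.intermediate_value (mem_Ioi.2 hb0)
    (mem_Ioi.2 ha0) h_cont ⟨hb.le, ha.le⟩
  exact ⟨l, hl, h_zero⟩

/-- Fibering-map analysis (Lemma 2.2 of the paper): for `q > 2`, `A, C > 0`, `B ∈ ℝ`,
the map `j(λ) = (A/2)λ² − (λ^q/q)(B + C log λ) + (C/q²)λ^q` tends to `0` as `λ → 0⁺`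
and to `−∞` as `λ → +∞`, and there is a unique `λ* > 0` such that
`λ j′(λ) = Aλ² − λ^q (B + C log λ)` is positive on `(0, λ*)`, zero at `λ*`, and
negative on `(λ*, ∞)`. -/
theorem fibering_map_analysis (q A B C : ℝ) (hq : 2 < q) (hA : 0 < A) (hC : 0 < C) :
    (Tendsto (fun l : ℝ => A / 2 * l ^ 2 - l ^ q / q * (B + C * Real.log l) + C / q ^ 2 * l ^ q)
        (nhdsWithin 0 (Ioi 0)) (nhds 0) ∧
      Tendsto (fun l : ℝ => A / 2 * l ^ 2 - l ^ q / q * (B + C * Real.log l) + C / q ^ 2 * l ^ q)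
        atTop atBot) ∧
    ∃! lstar : ℝ, 0 < lstar ∧
      (∀ l : ℝ, 0 < l → l < lstar → 0 < A * l ^ 2 - l ^ q * (B + C * Real.log l)) ∧
      A * lstar ^ 2 - lstar ^ q * (B + C * Real.log lstar) = 0 ∧
      (∀ l : ℝ, lstar < l → A * l ^ 2 - l ^ q * (B + C * Real.log l) < 0) := by
  refine ⟨⟨tendsto_fibering_nhdsGT_zero A B C (by linarith), tendsto_fibering_atTop A B hq hC⟩, ?_⟩
  have h_factor : ∀ l : ℝ, 0 < l → A * l ^ 2 - l ^ q * (B + C * Real.log l) =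
      l ^ q * (A * l ^ (2 - q) - (B + C * Real.log l)) := by
    intro l hl
    rw [sq_eq_rpow_mul_rpow_two_sub q hl]
    ring
  have h_anti := strictAntiOn_rpow_two_sub_sub_log B hq hA hC
  obtain ⟨s, hs, h_zero⟩ := exists_pos_rpow_two_sub_sub_log_eq_zero B hq hA hC
  have h_pos : ∀ l : ℝ, 0 < l → l < s → 0 < A * l ^ 2 - l ^ q * (B + C * Real.log l) := by
    intro l hl hls
    rw [h_factor l hl]
    exact mul_pos (Real.rpow_pos_of_pos hl q) (h_zero.symm.trans_lt (h_anti hl hs hls))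
  have h_neg : ∀ l : ℝ, s < l → A * l ^ 2 - l ^ q * (B + C * Real.log l) < 0 := by
    intro l hsl
    have hl : 0 < l := hs.trans hsl
    rw [h_factor l hl]
    exact mul_neg_of_pos_of_neg (Real.rpow_pos_of_pos hl q)
      ((h_anti hs hl hsl).trans_eq h_zero)
  refine ⟨s, ⟨hs, h_pos, by rw [h_factor s hs, h_zero, mul_zero], h_neg⟩, ?_⟩
  rintro t ⟨ht, -, h_root, -⟩
  rcases lt_trichotomy t s with h | h | h
  · exact absurd h_root (h_pos t ht h).ne'
  · exact h
  · exact absurd h_root (h_neg t h).ne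
end

section
/- Let q > 2, μ₀ > 0, K > 0 and D > 0. Define ρ : (0, ∞) → ℝ by ρ(γ) = ( μ₀ e γ / K^{q+γ} )^{1/(q+γ−2)} · D^{γ/(q(q+γ−2))}. Then the supremum ρ* = sup_{γ ∈ (0,∞)} ρ(γ) is finite and strictly positive, and it is attained: there exists γ* ∈ (0, ∞) with ρ(γ*) = ρ* < +∞. -/
/-- The function `ρ(γ) = (μ₀ e γ / K^(q+γ))^(1/(q+γ−2)) · D^(γ/(q(q+γ−2)))`
from Lemma 2.5 of the paper. -/
noncomputable def rhoFun (q μ₀ K D γ : ℝ) : ℝ :=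
  (μ₀ * Real.exp 1 * γ / K ^ (q + γ)) ^ (1 / (q + γ - 2)) *
    D ^ (γ / (q * (q + γ - 2)))

/-- The equation `A + t = 1 + s * exp (-t)` has a real solution. -/
lemma exists_add_eq_one_add_mul_exp_neg (A s : ℝ) (hs : 0 ≤ s) :
    ∃ t : ℝ, A + t = 1 + s * Real.exp (-t) := by
  have hb : 0 ≤ s * Real.exp (A - 1) := by positivity
  have hle : 1 - A ≤ 1 - A + s * Real.exp (A - 1) := by linarith
  have hcont : ContinuousOn (fun t : ℝ => A + t - 1 - s * Real.exp (-t))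
      (Set.Icc (1 - A) (1 - A + s * Real.exp (A - 1))) := by fun_prop
  have hexp : s * Real.exp (-(1 - A + s * Real.exp (A - 1))) ≤ s * Real.exp (A - 1) :=
    mul_le_mul_of_nonneg_left (Real.exp_le_exp.mpr (by linarith)) hs
  have hneg : 0 ≤ s * Real.exp (-(1 - A)) := by positivity
  obtain ⟨t, -, ht⟩ := intermediate_value_Icc hle hcont
    (show (0 : ℝ) ∈ Set.Icc _ _ from ⟨by linarith, by linarith⟩)
  exact ⟨t, by linarith⟩

/-- The function `γ ↦ (A + log γ) / (γ + s)` attains a maximum on `(0, ∞)`. -/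
lemma exists_forall_add_log_div_le (A s : ℝ) (hs : 0 ≤ s) :
    ∃ γ₀ : ℝ, 0 < γ₀ ∧ ∀ γ : ℝ, 0 < γ →
      (A + Real.log γ) / (γ + s) ≤ (A + Real.log γ₀) / (γ₀ + s) := by
  obtain ⟨t, ht⟩ := exists_add_eq_one_add_mul_exp_neg A s hs
  refine ⟨Real.exp t, Real.exp_pos t, fun γ hγ => ?_⟩
  have hval : (A + Real.log (Real.exp t)) / (Real.exp t + s) = Real.exp (-t) := by
    have h1 : Real.exp (-t) * Real.exp t = 1 := by rw [← Real.exp_add]; simp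
    have h2 : 0 < Real.exp t + s := by positivity
    rw [div_eq_iff h2.ne', Real.log_exp]
    linear_combination ht - h1
  have hlog := Real.log_le_sub_one_of_pos (mul_pos hγ (Real.exp_pos (-t)))
  rw [Real.log_mul hγ.ne' (Real.exp_pos _).ne', Real.log_exp] at hlog
  rw [hval, div_le_iff₀ (by positivity)]
  linarith

lemma rhoFun_eq_exp {q μ₀ K D γ : ℝ} (hq : 2 < q) (hμ₀ : 0 < μ₀) (hK : 0 < K)
    (hD : 0 < D) (hγ : 0 < γ) :
    rhoFun q μ₀ K D γ = Real.exp ((Real.log D / q - Real.log K) +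
      (Real.log μ₀ + 1 - 2 * Real.log K - (q - 2) * Real.log D / q + Real.log γ) /
        (γ + (q - 2))) := by
  have hKp : 0 < K ^ (q + γ) := Real.rpow_pos_of_pos hK _
  have hμe : 0 < μ₀ * Real.exp 1 := by positivity
  have h1 : q + γ - 2 ≠ 0 := by linarith
  have h2 : γ + (q - 2) ≠ 0 := by linarith
  have h3 : q ≠ 0 := by linarith
  rw [rhoFun, Real.rpow_def_of_pos (by positivity), Real.rpow_def_of_pos hD, ← Real.exp_add,
    Real.log_div (by positivity) hKp.ne', Real.log_mul hμe.ne' hγ.ne',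
    Real.log_mul hμ₀.ne' (Real.exp_pos 1).ne', Real.log_exp, Real.log_rpow hK,
    show q + γ - 2 = γ + (q - 2) by ring]
  congr 1
  field_simp
  ring

/-- Lemma 2.5 of the paper (case `n = 1, 2`): the supremum of `ρ` over `(0, ∞)` is
finite, strictly positive, and attained at some `γ* > 0`. -/
theorem rho_sup_attained (q μ₀ K D : ℝ) (hq : 2 < q) (hμ₀ : 0 < μ₀) (hK : 0 < K)
    (hD : 0 < D) :
    ∃ γstar : ℝ, 0 < γstar ∧ 0 < rhoFun q μ₀ K D γstar ∧
      ∀ γ : ℝ, 0 < γ → rhoFun q μ₀ K D γ ≤ rhoFun q μ₀ K D γstar := by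
  obtain ⟨γ₀, hγ₀, hmax⟩ := exists_forall_add_log_div_le
    (Real.log μ₀ + 1 - 2 * Real.log K - (q - 2) * Real.log D / q) (q - 2) (by linarith)
  refine ⟨γ₀, hγ₀, ?_, fun γ hγ => ?_⟩
  · rw [rhoFun_eq_exp hq hμ₀ hK hD hγ₀]
    exact Real.exp_pos _
  · rw [rhoFun_eq_exp hq hμ₀ hK hD hγ₀, rhoFun_eq_exp hq hμ₀ hK hD hγ, Real.exp_le_exp]
    linarith [hmax γ hγ]
end

section
/- Let (Ω, μ) be a measure space with μ(Ω) < ∞, let p ≥ 0 and c₁ > 0, and let g : ℝ → ℝ satisfy s·g(s) ≥ |s|^{p+2} for all |s| ≤ 1 and s·g(s) ≥ c₁ |s|^{p+2} for all |s| > 1. Let v : Ω → ℝ be measurable with g∘v · v integrable. Then |v|² is integrable and ∫_Ω |v|² dμ ≤ max(c₁^{−2/(p+2)}, 1) · μ(Ω)^{p/(p+2)} · ( ∫_Ω g(v) v dμ )^{2/(p+2)}. -/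
open MeasureTheory

/-- On a finite measure space, if `f ≥ 0` and `f ^ r` is integrable with `1 ≤ r`, then `f` is
integrable and its integral is controlled by that of `f ^ r`. -/
theorem integral_le_measure_rpow_mul_integral_rpow {Ω : Type*} [MeasurableSpace Ω]
    {μ : Measure Ω} [IsFiniteMeasure μ] {r : ℝ} (hr : 1 ≤ r) {f : Ω → ℝ} (hf : Measurable f)
    (hf0 : ∀ x, 0 ≤ f x) (hint : Integrable (fun x => f x ^ r) μ) :
    Integrable f μ ∧
      ∫ x, f x ∂μ ≤ (μ Set.univ).toReal ^ (1 - 1 / r) * (∫ x, f x ^ r ∂μ) ^ (1 / r) := by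
  have hr0 : 0 < r := by linarith
  have hmem : MemLp f (ENNReal.ofReal r) μ := by
    rw [← integrable_norm_rpow_iff hf.aestronglyMeasurable (by simpa using hr0)
      ENNReal.ofReal_ne_top, ENNReal.toReal_ofReal hr0.le]
    simpa only [Real.norm_of_nonneg (hf0 _)] using hint
  refine ⟨hmem.integrable (by simpa using hr), ?_⟩
  rcases hr.eq_or_lt with rfl | hr1
  · simp
  · have hpq := Real.HolderConjugate.conjExponent hr1
    have h := integral_mul_le_Lp_mul_Lq_of_nonneg hpq (μ := μ) (f := f) (g := fun _ => (1 : ℝ))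
      (.of_forall hf0) (.of_forall fun _ => zero_le_one) hmem (memLp_const 1)
    have hexp : 1 / r.conjExponent = 1 - 1 / r := by
      have := hpq.inv_add_inv_eq_one
      simp only [one_div]
      linarith
    rw [hexp] at h
    simpa [Measure.real, mul_comm] using h

/-- Estimate (4.8) of the paper: on a finite measure space, if
`s g(s) ≥ |s|^(p+2)` for `|s| ≤ 1` and `s g(s) ≥ c₁|s|^(p+2)` for `|s| > 1`, then
`|v|²` is integrable and
`∫ |v|² ≤ max(c₁^(−2/(p+2)), 1) μ(Ω)^(p/(p+2)) (∫ g(v) v)^(2/(p+2))`. -/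
theorem kinetic_dissipation_bound {Ω : Type*} [MeasurableSpace Ω] (μ : Measure Ω)
    [IsFiniteMeasure μ] (p c₁ : ℝ) (hp : 0 ≤ p) (hc₁ : 0 < c₁) (g : ℝ → ℝ)
    (hg_small : ∀ s : ℝ, |s| ≤ 1 → |s| ^ (p + 2) ≤ s * g s)
    (hg_large : ∀ s : ℝ, 1 < |s| → c₁ * |s| ^ (p + 2) ≤ s * g s)
    (v : Ω → ℝ) (hv : Measurable v)
    (hint : Integrable (fun x => g (v x) * v x) μ) :
    Integrable (fun x => |v x| ^ 2) μ ∧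
      ∫ x, |v x| ^ 2 ∂μ ≤
        max (c₁ ^ (-(2 / (p + 2)))) 1 * (μ Set.univ).toReal ^ (p / (p + 2)) *
          (∫ x, g (v x) * v x ∂μ) ^ (2 / (p + 2)) := by
  have hp2 : 0 < p + 2 := by linarith
  set M : ℝ := max c₁⁻¹ 1
  have hM0 : 0 ≤ M := zero_le_one.trans (le_max_right _ _)
  have hbound : ∀ s : ℝ, |s| ^ (p + 2) ≤ M * (g s * s) := by
    intro s
    have hpow : 0 ≤ |s| ^ (p + 2) := by positivity
    rcases le_or_gt |s| 1 with h | h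
    · have h1 := hg_small s h
      rw [mul_comm s] at h1
      exact h1.trans (le_mul_of_one_le_left (hpow.trans h1) (le_max_right _ _))
    · have h1 := hg_large s h
      rw [mul_comm s] at h1
      calc |s| ^ (p + 2) = c₁⁻¹ * (c₁ * |s| ^ (p + 2)) := by field_simp
        _ ≤ c₁⁻¹ * (g s * s) := by gcongr
        _ ≤ M * (g s * s) := by
          gcongr
          · exact (by positivity : 0 ≤ c₁ * |s| ^ (p + 2)).trans h1
          · exact le_max_left _ _
  have hrpow : ∀ x, (|v x| ^ 2) ^ ((p + 2) / 2) = |v x| ^ (p + 2) := by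
    intro x
    rw [← Real.rpow_natCast, ← Real.rpow_mul (abs_nonneg _)]
    congr 1
    push_cast
    ring
  have hvint : Integrable (fun x => |v x| ^ (p + 2)) μ := by
    refine (hint.const_mul M).mono' (by fun_prop (disch := positivity)) (.of_forall fun x => ?_)
    rw [Real.norm_of_nonneg (by positivity)]
    exact hbound (v x)
  have hmeas : Measurable fun x => |v x| ^ 2 := by
    simp only [sq_abs]
    fun_prop
  obtain ⟨hsq, hle⟩ := integral_le_measure_rpow_mul_integral_rpow (μ := μ)
    (r := (p + 2) / 2) (by linarith) hmeas (fun x => by positivity)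
    (by simpa only [hrpow] using hvint)
  refine ⟨hsq, hle.trans ?_⟩
  have hexp : 1 / ((p + 2) / 2) = 2 / (p + 2) := by field_simp
  have hexp' : 1 - 2 / (p + 2) = p / (p + 2) := by
    field_simp
    ring
  have hMpow : M ^ (2 / (p + 2)) = max (c₁ ^ (-(2 / (p + 2)))) 1 := by
    have hmono : MonotoneOn (fun x : ℝ => x ^ (2 / (p + 2))) (Set.Ici 0) :=
      Real.monotoneOn_rpow_Ici_of_exponent_nonneg (by positivity)
    have h := hmono.map_max (a := c₁⁻¹) (b := 1) (inv_nonneg.2 hc₁.le) (zero_le_one' ℝ)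
    simpa only [Real.one_rpow, Real.inv_rpow hc₁.le, ← Real.rpow_neg hc₁.le] using h
  have hG : 0 ≤ ∫ x, g (v x) * v x ∂μ := by
    refine integral_nonneg fun x => ?_
    have h0 : 0 ≤ M * (g (v x) * v x) := le_trans (by positivity) (hbound (v x))
    exact nonneg_of_mul_nonneg_right h0 (zero_lt_one.trans_le (le_max_right _ _))
  simp only [hrpow, hexp, hexp']
  rw [← hMpow, mul_comm (M ^ _), mul_assoc, ← Real.mul_rpow hM0 hG, ← integral_const_mul]
  gcongr
  · exact hint.const_mul M
  · exact fun x => hbound (v x)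
end
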